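/- Limit of the quasilinear gain for large actuator-bound variability. Fix μ₁, μ₂, α, β ∈ ℝ, σ₁ > 0 and ρ ∈ (−1, 1), and for σ₂ > 0 define N₁(σ₂) = ∫_{t₀}^{∞} (√2·e^{−t²/2}/(4√π))·[erf(γ₁(t)) + erf(γ₂(t))] dt, where γ₁, γ₂ and t₀ depend on σ₂ as specified. Then N₁(σ₂) → 1/2 as σ₂ → ∞. -/

import Mathlib

open MeasureTheory

/-- The error function `erf x = (2/√π) ∫₀ˣ e^{−s²} ds`. -/
noncomputable def erf (x : ℝ) : ℝ :=
  (2 / Real.sqrt Real.pi) * ∫ s in (0 : ℝ)..x, Real.exp (-s ^ 2)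
/-- `γ₁(t) = √2 (μ₁ − α + μ₂ + (σ₂ + ρσ₁) t) / (2σ₁ √(1−ρ²))`. -/
noncomputable def gamma1 (μ₁ μ₂ σ₁ σ₂ ρ α : ℝ) (t : ℝ) : ℝ :=
  Real.sqrt 2 * (μ₁ - α + μ₂ + (σ₂ + ρ * σ₁) * t) / (2 * σ₁ * Real.sqrt (1 - ρ ^ 2))

/-- `γ₂(t) = √2 (β − μ₁ + μ₂ + (σ₂ − ρσ₁) t) / (2σ₁ √(1−ρ²))`. -/
noncomputable def gamma2 (μ₁ μ₂ σ₁ σ₂ ρ β : ℝ) (t : ℝ) : ℝ :=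
  Real.sqrt 2 * (β - μ₁ + μ₂ + (σ₂ - ρ * σ₁) * t) / (2 * σ₁ * Real.sqrt (1 - ρ ^ 2))


open Filter Set Topology

theorem integrable_exp_neg_sq : Integrable fun s : ℝ => Real.exp (-s ^ 2) := by
  simpa using integrable_exp_neg_mul_sq (b := 1) one_pos

theorem continuous_erf : Continuous erf :=
  continuous_const.mul (intervalIntegral.continuous_primitive
    (fun _ _ => integrable_exp_neg_sq.intervalIntegrable) 0)

theorem abs_erf_le_two (x : ℝ) : |erf x| ≤ 2 := by
  have hpi : 0 < √Real.pi := Real.sqrt_pos.2 Real.pi_pos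
  have hint : |∫ s in (0 : ℝ)..x, Real.exp (-s ^ 2)| ≤ √Real.pi := by
    calc |∫ s in (0 : ℝ)..x, Real.exp (-s ^ 2)|
        ≤ ∫ s in Set.uIoc 0 x, ‖Real.exp (-s ^ 2)‖ :=
          (Real.norm_eq_abs _).symm.trans_le
            intervalIntegral.norm_integral_le_integral_norm_uIoc
      _ ≤ ∫ s : ℝ, ‖Real.exp (-s ^ 2)‖ :=
          setIntegral_le_integral integrable_exp_neg_sq.norm
            (Eventually.of_forall fun _ => norm_nonneg _)
      _ = √Real.pi := by simpa using integral_gaussian 1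
  rw [erf, abs_mul, abs_of_pos (by positivity)]
  calc 2 / √Real.pi * |∫ s in (0 : ℝ)..x, Real.exp (-s ^ 2)|
      ≤ 2 / √Real.pi * √Real.pi := by gcongr
    _ = 2 := by field_simp

theorem tendsto_erf_atTop : Tendsto erf atTop (𝓝 1) := by
  have hpi : 0 < √Real.pi := Real.sqrt_pos.2 Real.pi_pos
  have h := (intervalIntegral_tendsto_integral_Ioi 0
    integrable_exp_neg_sq.integrableOn tendsto_id).const_mul (2 / √Real.pi)
  have hval : ∫ s in Ioi (0 : ℝ), Real.exp (-s ^ 2) = √Real.pi / 2 := by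
    simpa using integral_gaussian_Ioi 1
  rw [hval, show 2 / √Real.pi * (√Real.pi / 2) = 1 by field_simp] at h
  exact h

theorem continuous_gamma1 (μ₁ μ₂ σ₁ σ₂ ρ α : ℝ) : Continuous (gamma1 μ₁ μ₂ σ₁ σ₂ ρ α) := by
  unfold gamma1
  fun_prop

theorem continuous_gamma2 (μ₁ μ₂ σ₁ σ₂ ρ β : ℝ) : Continuous (gamma2 μ₁ μ₂ σ₁ σ₂ ρ β) := by
  unfold gamma2
  fun_prop

theorem tendsto_gamma1_atTop {σ₁ ρ t : ℝ} (μ₁ μ₂ α : ℝ) (hσ₁ : 0 < σ₁)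
    (hρ : ρ ∈ Set.Ioo (-1 : ℝ) 1) (ht : 0 < t) :
    Tendsto (fun σ₂ => gamma1 μ₁ μ₂ σ₁ σ₂ ρ α t) atTop atTop := by
  have hρ' : 0 < √(1 - ρ ^ 2) := Real.sqrt_pos.2 (by nlinarith [hρ.1, hρ.2])
  exact ((tendsto_atTop_add_const_left _ _ ((tendsto_atTop_add_const_right _ _
    tendsto_id).atTop_mul_const ht)).const_mul_atTop (by positivity)).atTop_div_const
    (by positivity)

theorem gamma2_eq_gamma1 (μ₁ μ₂ σ₁ σ₂ ρ β t : ℝ) :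
    gamma2 μ₁ μ₂ σ₁ σ₂ ρ β t = gamma1 (-μ₁) μ₂ σ₁ σ₂ (-ρ) (-β) t := by
  simp only [gamma1, gamma2, neg_sq]
  ring

theorem tendsto_gamma2_atTop {σ₁ ρ t : ℝ} (μ₁ μ₂ β : ℝ) (hσ₁ : 0 < σ₁)
    (hρ : ρ ∈ Set.Ioo (-1 : ℝ) 1) (ht : 0 < t) :
    Tendsto (fun σ₂ => gamma2 μ₁ μ₂ σ₁ σ₂ ρ β t) atTop atTop := by
  simp only [gamma2_eq_gamma1]
  exact tendsto_gamma1_atTop _ _ _ hσ₁ ⟨by linarith [hρ.2], by linarith [hρ.1]⟩ ht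

theorem tendsto_setIntegral_Ioi_of_dominated {ι : Type*} {l : Filter ι}
    [l.IsCountablyGenerated] {a : ι → ℝ} {a₀ : ℝ} {F : ι → ℝ → ℝ} {f bound : ℝ → ℝ}
    (ha : Tendsto a l (𝓝 a₀)) (hF : ∀ i, AEStronglyMeasurable (F i))
    (hbound : ∀ i t, ‖F i t‖ ≤ bound t) (hint : Integrable bound)
    (hlim : ∀ t, a₀ < t → Tendsto (fun i => F i t) l (𝓝 (f t))) :
    Tendsto (fun i => ∫ t in Ioi (a i), F i t) l (𝓝 (∫ t in Ioi a₀, f t)) := by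
  simp only [← integral_indicator measurableSet_Ioi]
  refine tendsto_integral_filter_of_dominated_convergence bound
    (Eventually.of_forall fun i => (hF i).indicator measurableSet_Ioi)
    (Eventually.of_forall fun i => Eventually.of_forall fun t =>
      (norm_indicator_le_norm_self _ _).trans (hbound i t)) hint ?_
  filter_upwards [Measure.ae_ne volume a₀] with t ht
  rcases lt_or_gt_of_ne ht with ht | ht
  · rw [indicator_of_notMem (by simpa using ht.le)]
    refine tendsto_const_nhds.congr' ?_
    filter_upwards [ha.eventually (lt_mem_nhds ht)] with i hi
    rw [indicator_of_notMem (by simpa using hi.le)]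
  · rw [indicator_of_mem (by simpa using ht)]
    refine (hlim t ht).congr' ?_
    filter_upwards [ha.eventually (gt_mem_nhds ht)] with i hi
    rw [indicator_of_mem (by simpa using hi)]

theorem integrable_gaussian_weight :
    Integrable fun t : ℝ => √2 * Real.exp (-t ^ 2 / 2) / (4 * √Real.pi) := by
  have h : Integrable fun t : ℝ => Real.exp (-t ^ 2 / 2) := by
    convert integrable_exp_neg_mul_sq (b := 1 / 2) (by norm_num) using 3
    ring
  exact (h.const_mul _).div_const _

theorem integral_Ioi_gaussian_weight :
    ∫ t in Ioi (0 : ℝ), √2 * Real.exp (-t ^ 2 / 2) / (4 * √Real.pi) = 1 / 4 := by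
  have hpi : 0 < √Real.pi := Real.sqrt_pos.2 Real.pi_pos
  have h : ∫ t in Ioi (0 : ℝ), Real.exp (-t ^ 2 / 2) = √Real.pi * √2 / 2 := by
    rw [← Real.sqrt_mul Real.pi_pos.le]
    convert integral_gaussian_Ioi (1 / 2) using 4
    · ring
    · ring
  rw [integral_div, integral_const_mul, h]
  field_simp
  norm_num

/-- **Limit of the quasilinear gain for large actuator-bound variability:**
`N₁(σ₂) → 1/2` as `σ₂ → ∞`. -/
theorem gain_tendsto_half
    (μ₁ μ₂ σ₁ ρ α β : ℝ) (hσ₁ : 0 < σ₁) (hρ : ρ ∈ Set.Ioo (-1 : ℝ) 1) :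
    Filter.Tendsto
      (fun σ₂ : ℝ =>
        ∫ t in Set.Ioi ((max α (-β) - μ₂) / σ₂),
          Real.sqrt 2 * Real.exp (-t ^ 2 / 2) / (4 * Real.sqrt Real.pi) *
            (erf (gamma1 μ₁ μ₂ σ₁ σ₂ ρ α t) + erf (gamma2 μ₁ μ₂ σ₁ σ₂ ρ β t)))
      Filter.atTop (nhds (1 / 2)) := by
  have ha : Tendsto (fun σ₂ : ℝ => (max α (-β) - μ₂) / σ₂) atTop (𝓝 0) :=
    tendsto_const_nhds.div_atTop tendsto_id
  have hval : ∫ t in Ioi (0 : ℝ), √2 * Real.exp (-t ^ 2 / 2) / (4 * √Real.pi) * (1 + 1)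
      = 1 / 2 := by
    rw [integral_mul_const, integral_Ioi_gaussian_weight]
    norm_num
  rw [← hval]
  refine tendsto_setIntegral_Ioi_of_dominated ha (fun σ₂ => ?_) (fun σ₂ t => ?_)
    (integrable_gaussian_weight.mul_const (2 + 2)) (fun t ht => ?_)
  · exact integrable_gaussian_weight.aestronglyMeasurable.mul
      ((continuous_erf.comp (continuous_gamma1 ..)).add
        (continuous_erf.comp (continuous_gamma2 ..))).aestronglyMeasurable
  · rw [norm_mul, Real.norm_of_nonneg (by positivity)]
    gcongr
    exact (abs_add_le _ _).trans (add_le_add (abs_erf_le_two _) (abs_erf_le_two _))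
  · exact ((tendsto_erf_atTop.comp (tendsto_gamma1_atTop _ _ _ hσ₁ hρ ht)).add
      (tendsto_erf_atTop.comp (tendsto_gamma2_atTop _ _ _ hσ₁ hρ ht))).const_mul _
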